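/- Let C = {x ∈ ℝ≥0 × ℝ≥0 | x.2 ≤ x.1} and D = ℝ≥0 × ℝ≥0, with the bilinear pairing ⟨x, y⟩ = x.1 * y.1 + x.2 * y.2, and let w(D,C) be the topology on D generated by the sets {y | r < ⟨x, y⟩} for x ∈ C and r : ℝ≥0. Then the second projection π₂ : D → ℝ≥0, y ↦ y.2, is not lower semicontinuous for w(D,C): the set {y ∈ D | 1 < y.2} is not w(D,C)-open. -/

import Mathlib

open scoped ENNReal NNReal Topology

/-- The weak upper topology `w(D,C)` on `D = ℝ≥0 × ℝ≥0` determined by the cone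
`C = {x | x.2 ≤ x.1}` via the standard inner product pairing. -/
def weakUpperSierpinski : TopologicalSpace (ℝ≥0 × ℝ≥0) :=
  TopologicalSpace.generateFrom
    {S | ∃ x : ℝ≥0 × ℝ≥0, x.2 ≤ x.1 ∧ ∃ r : ℝ≥0,
      S = {y : ℝ≥0 × ℝ≥0 | r < x.1 * y.1 + x.2 * y.2}}

/-- The second projection `π₂ : ℝ≥0 × ℝ≥0 → ℝ≥0` is not lower semicontinuous
for the weak upper topology `w(D,C)`: the set `{y | 1 < y.2}` is not open. -/
theorem pi2_not_lsc_weakUpperSierpinski :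
    ¬ IsOpen[weakUpperSierpinski] {y : ℝ≥0 × ℝ≥0 | 1 < y.2} := by
  intro h
  have key : ∀ U : Set (ℝ≥0 × ℝ≥0), IsOpen[weakUpperSierpinski] U →
      ((0, 2) : ℝ≥0 × ℝ≥0) ∈ U → ((2, 0) : ℝ≥0 × ℝ≥0) ∈ U := by
    intro U hU
    induction hU with
    | basic S hS =>
      obtain ⟨x, hx, r, rfl⟩ := hS
      intro h1
      simp only [Set.mem_setOf_eq, mul_zero, zero_add, add_zero] at h1 ⊢
      exact lt_of_lt_of_le h1 (mul_le_mul_left hx 2)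
    | univ => exact fun _ => Set.mem_univ _
    | inter s t _ _ hs ht => exact fun h1 => ⟨hs h1.1, ht h1.2⟩
    | sUnion S _ ih =>
      rintro ⟨t, ht, h1⟩
      exact ⟨t, ht, ih t ht h1⟩
  have h2 := key _ h (by simp)
  simp at h2
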